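/- Let τ be an ℵ₀-tangle of G and X a finite set of vertices such that the ultrafilter U(τ,X) is non-principal. Then U(τ',X) ≠ U(τ,X) for every ℵ₀-tangle τ' of G with τ' ≠ τ. -/

import Mathlib

open Set

variable {V : Type*}

/-- `{A,B}` is a separation of `G`: `A ∪ B = V` and no edge between `A∖B` and `B∖A`. -/
def IsSep (G : SimpleGraph V) (A B : Set V) : Prop :=
  A ∪ B = Set.univ ∧ ∀ a ∈ A \ B, ∀ b ∈ B \ A, ¬ G.Adj a b

/-- A separation of finite order. -/
def IsFinSep (G : SimpleGraph V) (A B : Set V) : Prop :=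
  IsSep G A B ∧ (A ∩ B).Finite

/-- The set `S⃗` of oriented finite-order separations of `G`, as ordered pairs. -/
def Svec (G : SimpleGraph V) : Set (Set V × Set V) :=
  {p | IsFinSep G p.1 p.2}

/-- `(A,B) ≤ (C,D)` iff `A ⊆ C` and `D ⊆ B`. -/
def sepLE (p q : Set V × Set V) : Prop :=
  p.1 ⊆ q.1 ∧ q.2 ⊆ p.2

/-- An orientation of the set `S` of finite-order separations: a subset of `S⃗` containing
exactly one of `(A,B)`, `(B,A)` for every finite-order separation `{A,B}`. -/
def IsOrientation (G : SimpleGraph V) (O : Set (Set V × Set V)) : Prop :=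
  O ⊆ Svec G ∧ ∀ A B : Set V, IsFinSep G A B → ((A, B) ∈ O ↔ (B, A) ∉ O)

/-- Consistency: no two distinct members `(B,A)`, `(C,D)` with `(A,B) < (C,D)`. -/
def Consistent (O : Set (Set V × Set V)) : Prop :=
  ∀ A B C D : Set V, (B, A) ∈ O → (C, D) ∈ O → (B, A) ≠ (C, D) →
    ¬ (sepLE (A, B) (C, D) ∧ (A, B) ≠ (C, D))

/-- A star in `S⃗`: every two distinct elements point towards each other. -/
def IsStar (G : SimpleGraph V) (σ : Set (Set V × Set V)) : Prop :=
  σ ⊆ Svec G ∧ ∀ p ∈ σ, ∀ q ∈ σ, p ≠ q → sepLE p (q.2, q.1)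

/-- Membership in `T_n`: a star of at most `n` elements whose target sides have finite
intersection. -/
def InTn (G : SimpleGraph V) (n : ℕ) (σ : Set (Set V × Set V)) : Prop :=
  IsStar G σ ∧ σ.Finite ∧ σ.ncard ≤ n ∧ (⋂ p ∈ σ, p.2).Finite

/-- Membership in `T`: an arbitrary star whose target sides have finite intersection. -/
def InT (G : SimpleGraph V) (σ : Set (Set V × Set V)) : Prop :=
  IsStar G σ ∧ (⋂ p ∈ σ, p.2).Finite

/-- An `ℵ₀`-tangle of `G`: a consistent orientation of `S` with no subset in `T₃`. -/
def IsTangle (G : SimpleGraph V) (τ : Set (Set V × Set V)) : Prop :=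
  IsOrientation G τ ∧ Consistent τ ∧ ∀ σ ⊆ τ, ¬ InTn G 3 σ

/-- A `T`-tangle of `S`: a consistent orientation of `S` with no subset in `T`. -/
def IsTTangle (G : SimpleGraph V) (τ : Set (Set V × Set V)) : Prop :=
  IsOrientation G τ ∧ Consistent τ ∧ ∀ σ ⊆ τ, ¬ InT G σ

/-- The set `𝒞_X` of (vertex sets of) connected components of `G − X`. -/
def Comps (G : SimpleGraph V) (X : Set V) : Set (Set V) :=
  {C | ∃ c : (G.induce Xᶜ).ConnectedComponent, C = Subtype.val '' c.supp}

/-- A collection of subsets of `α` is an ultrafilter on `α`. -/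
def IsUltra {α : Type*} (F : Set (Set α)) : Prop :=
  ∅ ∉ F ∧ (∀ s ∈ F, ∀ t ∈ F, s ∩ t ∈ F) ∧ (∀ s ∈ F, ∀ t : Set α, s ⊆ t → t ∈ F) ∧
    ∀ s : Set α, s ∈ F ∨ sᶜ ∈ F

/-- A principal ultrafilter, generated by a single point. -/
def IsPrincipalUF {α : Type*} (F : Set (Set α)) : Prop :=
  ∃ a : α, F = {s | a ∈ s}

/-- `U(τ,X)`: the collection of all sets `𝒮` of components of `G − X` with
`(⋃(𝒞_X∖𝒮) ∪ X, ⋃𝒮 ∪ X) ∈ τ`. -/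
def tangleUF (G : SimpleGraph V) (τ : Set (Set V × Set V)) (X : Set V) :
    Set (Set ↥(Comps G X)) :=
  {𝒮 | ((⋃ C ∈ 𝒮ᶜ, (C : Set V)) ∪ X, (⋃ C ∈ 𝒮, (C : Set V)) ∪ X) ∈ τ}

/-- `f_{X',X}`: the pushforward of an ultrafilter on `𝒞_{X'}` along the map sending each
component of `G − X'` to the component of `G − X` containing it. -/
def pushUF (G : SimpleGraph V) (X X' : Set V) (F : Set (Set ↥(Comps G X'))) :
    Set (Set ↥(Comps G X)) :=
  {𝒮 | {C' : ↥(Comps G X') | ∃ C ∈ 𝒮, (C' : Set V) ⊆ (C : Set V)} ∈ F}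

/-- A direction in `G`: a choice of a component of `G − X` for every finite `X ⊆ V`,
compatible under inclusion. -/
def IsDirection (G : SimpleGraph V) (f : Set V → Set V) : Prop :=
  (∀ X : Set V, X.Finite → f X ∈ Comps G X) ∧
    ∀ X X' : Set V, X.Finite → X'.Finite → X ⊆ X' → f X' ⊆ f X

section Separations

variable {G : SimpleGraph V} {A B C D : Set V}

theorem IsFinSep.symm (h : IsFinSep G A B) : IsFinSep G B A := by
  refine ⟨⟨by rw [union_comm]; exact h.1.1, fun a ha b hb hab => ?_⟩, ?_⟩
  · exact h.1.2 b hb a ha hab.symm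
  · rw [inter_comm]; exact h.2

theorem IsFinSep.inter_union (h : IsFinSep G A B) (h' : IsFinSep G C D) :
    IsFinSep G (A ∩ C) (B ∪ D) := by
  obtain ⟨⟨hu, he⟩, hf⟩ := h
  obtain ⟨⟨hu', he'⟩, hf'⟩ := h'
  simp only [eq_univ_iff_forall, mem_union, mem_sdiff] at hu he hu' he'
  refine ⟨⟨?_, ?_⟩, (hf.union hf').subset ?_⟩
  · simp only [eq_univ_iff_forall, mem_union, mem_inter_iff]
    intro x
    have := hu x
    have := hu' x
    tauto
  · simp only [mem_sdiff, mem_union, mem_inter_iff]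
    intro a ha b hb hab
    have h₁ := he a ⟨ha.1.1, fun h => ha.2 (Or.inl h)⟩ b
    have h₂ := he' a ⟨ha.1.2, fun h => ha.2 (Or.inr h)⟩ b
    have := hu b
    have := hu' b
    tauto
  · rintro x ⟨⟨hA, hC⟩, hB | hD⟩
    exacts [Or.inl ⟨hA, hB⟩, Or.inr ⟨hC, hD⟩]

end Separations

namespace IsTangle

variable {G : SimpleGraph V} {τ : Set (Set V × Set V)} {A B C D : Set V}

theorem isFinSep (hτ : IsTangle G τ) (h : (A, B) ∈ τ) : IsFinSep G A B :=
  hτ.1.1 h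

theorem mem_or_swap_mem (hτ : IsTangle G τ) (h : IsFinSep G A B) : (A, B) ∈ τ ∨ (B, A) ∈ τ := by
  have := hτ.1.2 A B h
  tauto

theorem infinite_right (hτ : IsTangle G τ) (h : (A, B) ∈ τ) : B.Infinite := by
  intro hB
  refine hτ.2.2 {(A, B)} (by simpa using h) ⟨⟨?_, ?_⟩, finite_singleton _, by simp, by simpa⟩
  · simpa using hτ.1.1 h
  · rintro p rfl q rfl hpq
    exact absurd rfl hpq

/-- Tangles are closed downwards. -/
theorem mem_of_le (hτ : IsTangle G τ) (h : (C, D) ∈ τ) (hs : IsFinSep G A B)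
    (hAC : A ⊆ C) (hDB : D ⊆ B) : (A, B) ∈ τ := by
  refine (hτ.mem_or_swap_mem hs).resolve_right fun hBA => ?_
  have hAB : (A, B) ∉ τ := (hτ.1.2 B A hs.symm).1 hBA
  refine hτ.2.1 A B C D hBA h ?_ ⟨⟨hAC, hDB⟩, fun he => hAB (he ▸ h)⟩
  rintro he
  obtain ⟨rfl, rfl⟩ := Prod.mk.inj he
  exact hτ.infinite_right hBA (by simpa [inter_eq_left.2 hAC] using hs.2)

/-- Tangles are closed under binary joins. -/
theorem union_inter_mem (hτ : IsTangle G τ) (h : (A, B) ∈ τ) (h' : (C, D) ∈ τ) :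
    (A ∪ C, B ∩ D) ∈ τ := by
  have hs := hτ.isFinSep h
  have hs' := hτ.isFinSep h'
  have hcorner : IsFinSep G (B ∩ D) (A ∪ C) := hs.symm.inter_union hs'.symm
  refine (hτ.mem_or_swap_mem hcorner.symm).resolve_right fun hswap => ?_
  have hc : (A ∩ D, B ∪ C) ∈ τ :=
    hτ.mem_of_le h (hs.inter_union hs'.symm) inter_subset_left subset_union_left
  have hsub : ({(A ∩ D, B ∪ C), (C, D), (B ∩ D, A ∪ C)} : Set (Set V × Set V)) ⊆ τ := by
    rintro p (rfl | rfl | rfl) <;> assumption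
  refine hτ.2.2 _ hsub ⟨⟨hsub.trans hτ.1.1, ?_⟩, toFinite _, ?_, ?_⟩
  · rintro p (rfl | rfl | rfl) q (rfl | rfl | rfl) hpq <;>
      first
      | exact absurd rfl hpq
      | exact ⟨fun x hx => by simp only [mem_inter_iff, mem_union] at *; tauto,
          fun x hx => by simp only [mem_inter_iff, mem_union] at *; tauto⟩
  · exact (ncard_insert_le _ _).trans (Nat.succ_le_succ
      ((ncard_insert_le _ _).trans (by rw [ncard_singleton])))
  · refine (hs.2.union hs'.2).subset fun x hx => ?_
    simp only [mem_insert_iff, mem_singleton_iff, iInter_iInter_eq_or_left, iInter_iInter_eq_left,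
      mem_inter_iff, mem_union] at hx ⊢
    tauto

theorem infinite_inter (hτ : IsTangle G τ) (h : (A, B) ∈ τ) (h' : (C, D) ∈ τ) :
    (B ∩ D).Infinite :=
  hτ.infinite_right (hτ.union_inter_mem h h')

end IsTangle

section Components

variable {G : SimpleGraph V} {X : Set V}

theorem exists_mem_comps {v : V} (hv : v ∉ X) : ∃ C : Comps G X, v ∈ (C : Set V) :=
  ⟨⟨_, (G.induce Xᶜ).connectedComponentMk ⟨v, hv⟩, rfl⟩, ⟨v, hv⟩, rfl, rfl⟩

theorem notMem_of_mem_comps {C : Comps G X} {v : V} (h : v ∈ (C : Set V)) : v ∉ X := by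
  obtain ⟨_, c, rfl⟩ := C
  obtain ⟨w, -, rfl⟩ := h
  exact w.2

theorem comps_eq_of_mem {C D : Comps G X} {v : V} (hC : v ∈ (C : Set V)) (hD : v ∈ (D : Set V)) :
    C = D := by
  obtain ⟨_, c, rfl⟩ := C
  obtain ⟨_, d, rfl⟩ := D
  obtain ⟨w, hw, rfl⟩ := hC
  obtain ⟨w', hw', he⟩ := hD
  obtain rfl := Subtype.ext he
  obtain rfl : c = d := hw.symm.trans hw'
  rfl

theorem mem_comps_of_adj {C : Comps G X} {a b : V} (ha : a ∈ (C : Set V)) (hb : b ∉ X)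
    (hab : G.Adj a b) : b ∈ (C : Set V) := by
  obtain ⟨_, c, rfl⟩ := C
  obtain ⟨w, rfl, rfl⟩ := ha
  refine ⟨⟨b, hb⟩, ?_, rfl⟩
  refine SimpleGraph.ConnectedComponent.sound (SimpleGraph.Adj.reachable ?_)
  exact hab.symm

/-- A property passed along the edges inside a component holds on all of it or on none of it. -/
theorem comps_induction {C : Comps G X} {P : V → Prop}
    (hP : ∀ a ∈ (C : Set V), ∀ b ∈ (C : Set V), G.Adj a b → P a → P b)
    {a b : V} (ha : a ∈ (C : Set V)) (hb : b ∈ (C : Set V)) (h : P a) : P b := by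
  have hC := C.2
  obtain ⟨c, hc⟩ := hC
  rw [hc] at ha hb
  obtain ⟨u, hu, rfl⟩ := ha
  obtain ⟨v, hv, rfl⟩ := hb
  obtain ⟨p⟩ := SimpleGraph.ConnectedComponent.exact (hu.trans hv.symm)
  clear hv
  have huC : (u : V) ∈ (C : Set V) := hc ▸ ⟨u, hu, rfl⟩
  clear hu
  induction p with
  | nil => exact h
  | @cons _ w _ hadj p ih =>
    have hw := mem_comps_of_adj huC w.2 hadj
    exact ih (hP _ huC _ hw hadj h) hw

theorem disjoint_right_of_mem_left {A B : Set V} (hs : IsSep G A B) {C : Comps G X}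
    (hC : Disjoint (C : Set V) (A ∩ B)) {a : V} (ha : a ∈ (C : Set V)) (haA : a ∈ A) :
    Disjoint (C : Set V) B := by
  rw [Set.disjoint_left] at hC ⊢
  intro b hb hbB
  refine hC hb ⟨?_, hbB⟩
  refine comps_induction (P := (· ∈ A)) (fun x hx y hy hxy hxA => ?_) ha hb haA
  by_contra hyA
  have hyB : y ∈ B := by
    have : y ∈ A ∪ B := hs.1 ▸ mem_univ y
    exact this.resolve_left hyA
  exact hs.2 x ⟨hxA, fun hxB => hC hx ⟨hxA, hxB⟩⟩ y ⟨hyB, hyA⟩ hxy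

theorem finite_comps_not_disjoint {Y : Set V} (hY : Y.Finite) :
    {C : Comps G X | ¬ Disjoint (C : Set V) Y}.Finite := by
  refine (hY.biUnion (t := fun y => {C : Comps G X | y ∈ (C : Set V)}) fun y _ => ?_).subset ?_
  · exact Set.Subsingleton.finite fun C hC D hD => comps_eq_of_mem hC hD
  · intro C hC
    obtain ⟨y, hyC, hyY⟩ := Set.not_disjoint_iff.1 hC
    exact mem_biUnion hyY hyC

theorem isFinSep_comps (hX : X.Finite) (𝒮 : Set (Comps G X)) :
    IsFinSep G ((⋃ C ∈ 𝒮ᶜ, (C : Set V)) ∪ X) ((⋃ C ∈ 𝒮, (C : Set V)) ∪ X) := by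
  refine ⟨⟨eq_univ_of_forall fun v => ?_, ?_⟩, hX.subset ?_⟩
  · by_cases hv : v ∈ X
    · exact Or.inl (Or.inr hv)
    obtain ⟨C, hC⟩ := exists_mem_comps (G := G) hv
    by_cases hS : C ∈ 𝒮
    · exact Or.inr (Or.inl (mem_biUnion hS hC))
    · exact Or.inl (Or.inl (mem_biUnion (show C ∈ 𝒮ᶜ from hS) hC))
  · rintro a ⟨ha | ha, ha'⟩ b ⟨hb | hb, hb'⟩ hab
    · obtain ⟨C, hC, haC⟩ := mem_iUnion₂.1 ha
      have hbX : b ∉ X := fun h => hb' (Or.inr h)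
      exact hb' (Or.inl (mem_biUnion hC (mem_comps_of_adj haC hbX hab)))
    · exact hb' (Or.inr hb)
    · exact ha' (Or.inr ha)
    · exact ha' (Or.inr ha)
  · rintro v ⟨hv | hv, hv' | hv'⟩
    · obtain ⟨C, hC, hvC⟩ := mem_iUnion₂.1 hv
      obtain ⟨D, hD, hvD⟩ := mem_iUnion₂.1 hv'
      exact absurd (comps_eq_of_mem hvC hvD ▸ hD) hC
    all_goals assumption

end Components

section TangleUltrafilter

variable {G : SimpleGraph V} {τ τ' : Set (Set V × Set V)} {X : Set V}

theorem isUltra_tangleUF (hτ : IsTangle G τ) (hX : X.Finite) : IsUltra (tangleUF G τ X) := by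
  refine ⟨fun h => hτ.infinite_right h (by simpa using hX), fun s hs t ht => ?_,
    fun s hs t hst => ?_, fun s => ?_⟩
  · refine hτ.mem_of_le (hτ.union_inter_mem hs ht) (isFinSep_comps hX _) ?_ ?_
    · rintro v (hv | hv)
      · obtain ⟨C, hC, hvC⟩ := mem_iUnion₂.1 hv
        rw [compl_inter] at hC
        exact hC.imp (fun h => Or.inl (mem_biUnion h hvC)) (fun h => Or.inl (mem_biUnion h hvC))
      · exact Or.inl (Or.inr hv)
    · rintro v ⟨hv | hv, hv' | hv'⟩
      · obtain ⟨C, hC, hvC⟩ := mem_iUnion₂.1 hv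
        obtain ⟨D, hD, hvD⟩ := mem_iUnion₂.1 hv'
        exact Or.inl (mem_biUnion ⟨hC, comps_eq_of_mem hvC hvD ▸ hD⟩ hvC)
      all_goals exact Or.inr (by assumption)
  · exact hτ.mem_of_le hs (isFinSep_comps hX _)
      (union_subset_union_left _ (biUnion_subset_biUnion_left (compl_subset_compl.2 hst)))
      (union_subset_union_left _ (biUnion_subset_biUnion_left hst))
  · refine (hτ.mem_or_swap_mem (isFinSep_comps hX s)).imp id fun h => ?_
    simpa [tangleUF] using h

theorem IsUltra.compl_mem_of_finite {α : Type*} {F : Set (Set α)} (hF : IsUltra F)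
    (hnp : ¬ IsPrincipalUF F) {s : Set α} (hs : s.Finite) : sᶜ ∈ F := by
  obtain ⟨hempty, hinter, hmono, hcompl⟩ := hF
  induction s, hs using Set.Finite.induction_on with
  | empty =>
    rw [compl_empty]
    exact (hcompl univ).elim id fun h => hmono _ h _ (subset_univ _)
  | @insert a s _ _ ih =>
    have ha : {a}ᶜ ∈ F := by
      refine (hcompl {a}).resolve_left fun ha => hnp ⟨a, Set.ext fun t => ⟨fun ht => ?_, ?_⟩⟩
      · by_contra hat
        refine hempty ?_
        rw [← Set.singleton_inter_eq_empty.2 (show a ∉ t from hat)]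
        exact hinter _ ha _ ht
      · exact fun hat => hmono _ ha _ (singleton_subset_iff.2 hat)
    rw [insert_eq, compl_union]
    exact hinter _ ha _ ih

theorem subset_of_tangleUF_eq (hτ : IsTangle G τ) (hτ' : IsTangle G τ') (hX : X.Finite)
    (hnp : ¬ IsPrincipalUF (tangleUF G τ X)) (heq : tangleUF G τ' X = tangleUF G τ X) :
    τ ⊆ τ' := by
  rintro ⟨A, B⟩ hAB
  have hs := hτ.isFinSep hAB
  refine (hτ'.mem_or_swap_mem hs).resolve_right fun hBA => ?_
  have hU := isUltra_tangleUF hτ hX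
  rcases hU.2.2.2 {C | Disjoint (C : Set V) B} with h | h
  · refine hτ.infinite_inter hAB h (hX.subset ?_)
    rintro v ⟨hvB, hv | hv⟩
    · obtain ⟨C, hC, hvC⟩ := mem_iUnion₂.1 hv
      exact absurd hvB (Set.disjoint_left.1 hC hvC)
    · exact hv
  · have hN := hU.2.1 _ h _
      (hU.compl_mem_of_finite hnp (finite_comps_not_disjoint (G := G) (X := X) hs.2))
    rw [← heq] at hN
    refine hτ'.infinite_inter hBA hN (hX.subset ?_)
    rintro v ⟨hvA, hv | hv⟩
    · obtain ⟨C, ⟨hCB, hC⟩, hvC⟩ := mem_iUnion₂.1 hv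
      exact absurd (disjoint_right_of_mem_left hs.1 (not_not.1 hC) hvC hvA) hCB
    · exact hv

end TangleUltrafilter

/-- Lemma 3.3: if `U(τ,X)` is non-principal then no other `ℵ₀`-tangle `τ'`
has `U(τ',X) = U(τ,X)`. -/
theorem stmt12 [Infinite V] (G : SimpleGraph V) (τ τ' : Set (Set V × Set V))
    (hτ : IsTangle G τ) (hτ' : IsTangle G τ') (X : Set V) (hX : X.Finite)
    (hnp : ¬ IsPrincipalUF (tangleUF G τ X)) (hne : τ' ≠ τ) :
    tangleUF G τ' X ≠ tangleUF G τ X := by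
  intro heq
  refine hne (Subset.antisymm ?_ (subset_of_tangleUF_eq hτ hτ' hX hnp heq))
  exact subset_of_tangleUF_eq hτ' hτ hX (heq ▸ hnp) heq.symm
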